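/- Let r ≥ 1 and s ≥ 1 be integers, u < v, and let g be a real function that is (r+s)-times continuously differentiable on an open interval containing [u,v]. Then ∫_u^v g^{(r+s−1)}(t) (t − u)^{s−1} (v − t)^{r−1} dt = (v − u)^{r+s−1} · ∂^{r+s−2}/(∂u^{r−1} ∂v^{s−1}) ((g(v) − g(u))/(v − u)). Equivalently, E[g^{(r+s−1)}(B_{r,s}(u,v))] = (1/B(r,s)) · _{r−1}M_{s−1}(u,v). -/

import Mathlib

/-- `L(u,v) = (g(v) - g(u))/(v - u)`. -/
noncomputable def divDiff (g : ℝ → ℝ) (u v : ℝ) : ℝ := (g v - g u) / (v - u)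

/-- The mixed partial derivative `_iM_j(u,v) = ∂^{i+j}/(∂u^i ∂v^j) L(u,v)`. -/
noncomputable def mixedM (g : ℝ → ℝ) (i j : ℕ) (u v : ℝ) : ℝ :=
  iteratedDeriv i (fun x => iteratedDeriv j (fun y => divDiff g x y) v) u

open Set Filter Topology MeasureTheory in
lemma aux_deriv (h h' q w : ℝ → ℝ) (a b c z : ℝ) (hc : c ∈ Set.Ioo a b) (hz : z ∈ Set.Ioo a b)
    (hd : ∀ x ∈ Set.Ioo a b, HasDerivAt h (h' x) x) (hcont : ContinuousOn h' (Set.Ioo a b))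
    (hq : Continuous q) (hw : Continuous w) (hq01 : ∀ t ∈ Set.Icc (0:ℝ) 1, q t ∈ Set.Icc (0:ℝ) 1) :
    HasDerivAt (fun z => ∫ t in (0:ℝ)..1, h ((1 - q t) * c + q t * z) * w t)
      (∫ t in (0:ℝ)..1, h' ((1 - q t) * c + q t * z) * (q t * w t)) z := by
  obtain ⟨a', ha1, ha2⟩ := exists_between (lt_min hc.1 hz.1)
  obtain ⟨b', hb1, hb2⟩ := exists_between (max_lt hc.2 hz.2)
  rw [lt_min_iff] at ha2
  rw [max_lt_iff] at hb1
  have hsub : Icc a' b' ⊆ Ioo a b := fun x hx => ⟨ha1.trans_le hx.1, hx.2.trans_lt hb2⟩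
  have hmem : ∀ t ∈ Icc (0:ℝ) 1, ∀ y ∈ Ioo a' b', (1 - q t) * c + q t * y ∈ Icc a' b' := by
    intro t ht y hy
    obtain ⟨h0, h1⟩ := hq01 t ht
    have := (convex_Icc a' b') (x := c) ⟨ha2.1.le, hb1.1.le⟩ (y := y) ⟨hy.1.le, hy.2.le⟩
      (a := 1 - q t) (b := q t) (by linarith) h0 (by ring)
    simpa using this
  have hu : Icc (0:ℝ) 1 = uIcc 0 1 := (uIcc_of_le zero_le_one).symm
  have hhc : ContinuousOn h (Ioo a b) := fun x hx => (hd x hx).continuousAt.continuousWithinAt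
  have hcomp : ∀ k : ℝ → ℝ, ContinuousOn k (Ioo a b) → ∀ y ∈ Ioo a' b',
      ContinuousOn (fun t => k ((1 - q t) * c + q t * y)) (Icc 0 1) := by
    intro k hk y hy
    refine (hk.mono hsub).comp (t := Icc a' b') (by fun_prop) (fun t ht => hmem t ht y hy)
  have hF : ∀ y ∈ Ioo a' b', IntervalIntegrable (fun t => h ((1 - q t) * c + q t * y) * w t)
      volume 0 1 := by
    intro y hy
    apply ContinuousOn.intervalIntegrable
    rw [← hu]
    exact (hcomp h hhc y hy).mul hw.continuousOn
  have hF' : ∀ y ∈ Ioo a' b', IntervalIntegrable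
      (fun t => h' ((1 - q t) * c + q t * y) * (q t * w t)) volume 0 1 := by
    intro y hy
    apply ContinuousOn.intervalIntegrable
    rw [← hu]
    exact (hcomp h' hcont y hy).mul (hq.mul hw).continuousOn
  have hzz : z ∈ Ioo a' b' := ⟨ha2.2, hb1.2⟩
  have hnhds : Ioo a' b' ∈ 𝓝 z := isOpen_Ioo.mem_nhds hzz
  obtain ⟨C, hC⟩ := isCompact_Icc.exists_bound_of_continuousOn (hcont.mono hsub)
  have hU : Set.uIoc (0:ℝ) 1 ⊆ Icc 0 1 := by
    rw [uIoc_of_le zero_le_one]; exact Ioc_subset_Icc_self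
  refine (intervalIntegral.hasDerivAt_integral_of_dominated_loc_of_deriv_le
    (F := fun y t => h ((1 - q t) * c + q t * y) * w t)
    (F' := fun y t => h' ((1 - q t) * c + q t * y) * (q t * w t))
    (bound := fun t => C * ‖q t * w t‖) hnhds ?_ (hF z hzz) ?_ ?_ ?_ ?_).2
  · filter_upwards [hnhds] with y hy
    exact (intervalIntegrable_iff.1 (hF y hy)).aestronglyMeasurable
  · exact (intervalIntegrable_iff.1 (hF' z hzz)).aestronglyMeasurable
  · refine Eventually.of_forall fun t ht y hy => ?_
    rw [norm_mul]
    exact mul_le_mul_of_nonneg_right (hC _ (hmem t (hU ht) y hy)) (norm_nonneg _)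
  · exact (by fun_prop : Continuous fun t => C * ‖q t * w t‖).intervalIntegrable 0 1
  · refine Eventually.of_forall fun t ht y hy => ?_
    have h1 : HasDerivAt (fun y => (1 - q t) * c + q t * y) (q t) y := by
      simpa using ((hasDerivAt_id y).const_mul (q t)).const_add ((1 - q t) * c)
    have h2 := ((hd _ (hsub (hmem t (hU ht) y hy))).comp y h1).mul_const (w t)
    rw [← mul_assoc]
    exact h2

noncomputable def auxI (g : ℝ → ℝ) (i j : ℕ) (x y : ℝ) : ℝ :=
  ∫ t in (0:ℝ)..1, iteratedDeriv (i + j + 1) g ((1 - t) * x + t * y) * ((1 - t) ^ i * t ^ j)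

lemma aux_cont (g : ℝ → ℝ) (a b : ℝ) (n k : ℕ) (hk : k ≤ n)
    (hg : ContDiffOn ℝ n g (Set.Ioo a b)) :
    ContinuousOn (iteratedDeriv k g) (Set.Ioo a b) :=
  (hg.continuousOn_iteratedDerivWithin (m := k) (by exact_mod_cast hk)
    isOpen_Ioo.uniqueDiffOn).congr
    (fun _ hx => (iteratedDerivWithin_of_isOpen isOpen_Ioo hx).symm)

lemma aux_hasDeriv (g : ℝ → ℝ) (a b : ℝ) (n k : ℕ) (hk : k < n)
    (hg : ContDiffOn ℝ n g (Set.Ioo a b)) (x : ℝ) (hx : x ∈ Set.Ioo a b) :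
    HasDerivAt (iteratedDeriv k g) (iteratedDeriv (k + 1) g x) x := by
  have h1 : DifferentiableOn ℝ (iteratedDeriv k g) (Set.Ioo a b) :=
    (hg.differentiableOn_iteratedDerivWithin (m := k) (by exact_mod_cast hk)
      isOpen_Ioo.uniqueDiffOn).congr
      (fun _ hx => (iteratedDerivWithin_of_isOpen isOpen_Ioo hx).symm)
  rw [iteratedDeriv_succ]
  exact (h1.differentiableAt (isOpen_Ioo.mem_nhds hx)).hasDerivAt

lemma auxI_right (g : ℝ → ℝ) (a b : ℝ) (n i j : ℕ) (hk : i + j + 2 ≤ n)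
    (hg : ContDiffOn ℝ n g (Set.Ioo a b)) (x y : ℝ) (hx : x ∈ Set.Ioo a b)
    (hy : y ∈ Set.Ioo a b) : HasDerivAt (fun y => auxI g i j x y) (auxI g i (j + 1) x y) y := by
  have := aux_deriv (iteratedDeriv (i + j + 1) g) (iteratedDeriv (i + j + 1 + 1) g) (fun t => t)
    (fun t => (1 - t) ^ i * t ^ j) a b x y hx hy
    (aux_hasDeriv g a b n _ (by omega) hg) (aux_cont g a b n _ (by omega) hg)
    (by fun_prop) (by fun_prop) (fun t ht => ht)
  unfold auxI
  convert this using 1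
  apply intervalIntegral.integral_congr
  intro t _
  dsimp only
  rw [show i + (j + 1) + 1 = i + j + 1 + 1 by ring]
  ring

lemma auxI_left (g : ℝ → ℝ) (a b : ℝ) (n i j : ℕ) (hk : i + j + 2 ≤ n)
    (hg : ContDiffOn ℝ n g (Set.Ioo a b)) (x y : ℝ) (hx : x ∈ Set.Ioo a b)
    (hy : y ∈ Set.Ioo a b) : HasDerivAt (fun x => auxI g i j x y) (auxI g (i + 1) j x y) x := by
  have := aux_deriv (iteratedDeriv (i + j + 1) g) (iteratedDeriv (i + j + 1 + 1) g)
    (fun t => 1 - t)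
    (fun t => (1 - t) ^ i * t ^ j) a b y x hy hx
    (aux_hasDeriv g a b n _ (by omega) hg) (aux_cont g a b n _ (by omega) hg)
    (by fun_prop) (by fun_prop) (fun t ht => ⟨by linarith [ht.2], by linarith [ht.1]⟩)
  have e : i + 1 + j + 1 = i + j + 1 + 1 := by ring
  unfold auxI
  rw [e]
  convert this using 1
  · ext z
    congr 1
    ext t
    rw [show (1 - (1 - t)) * y + (1 - t) * z = (1 - t) * z + t * y by ring]
  · congr 1
    ext t
    rw [show (1 - (1 - t)) * y + (1 - t) * x = (1 - t) * x + t * y by ring]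
    ring

lemma auxI_subst (g : ℝ → ℝ) (i j : ℕ) (x y : ℝ) :
    ∫ t in x..y, iteratedDeriv (i + j + 1) g t * (t - x) ^ j * (y - t) ^ i =
      (y - x) ^ (i + j + 1) * auxI g i j x y := by
  have h := intervalIntegral.smul_integral_comp_add_mul (a := 0) (b := 1)
    (fun t => iteratedDeriv (i + j + 1) g t * (t - x) ^ j * (y - t) ^ i) (y - x) x
  rw [show x + (y - x) * 0 = x by ring, show x + (y - x) * 1 = y by ring] at h
  rw [← h, auxI, pow_succ', mul_assoc, smul_eq_mul]
  congr 1
  rw [← intervalIntegral.integral_const_mul]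
  apply intervalIntegral.integral_congr
  intro t _
  dsimp only
  rw [show x + (y - x) * t = (1 - t) * x + t * y by ring,
    show (1 - t) * x + t * y - x = (y - x) * t by ring,
    show y - ((1 - t) * x + t * y) = (y - x) * (1 - t) by ring, mul_pow, mul_pow, pow_add]
  ring

lemma auxI_zero (g : ℝ → ℝ) (a b : ℝ) (n : ℕ) (hk : 1 ≤ n)
    (hg : ContDiffOn ℝ n g (Set.Ioo a b)) (x y : ℝ) (hx : x ∈ Set.Ioo a b)
    (hy : y ∈ Set.Ioo a b) (hxy : x < y) : divDiff g x y = auxI g 0 0 x y := by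
  have h := auxI_subst g 0 0 x y
  have hsub : Set.uIcc x y ⊆ Set.Ioo a b := by
    rw [Set.uIcc_of_le hxy.le]
    exact fun t ht => ⟨hx.1.trans_le ht.1, ht.2.trans_lt hy.2⟩
  have h2 : ∫ t in x..y, iteratedDeriv (0 + 1) g t = iteratedDeriv 0 g y - iteratedDeriv 0 g x :=
    intervalIntegral.integral_eq_sub_of_hasDerivAt
      (fun t ht => aux_hasDeriv g a b n 0 (by omega) hg t (hsub ht))
      ((aux_cont g a b n _ (by omega) hg).mono hsub).intervalIntegrable
  simp only [pow_zero, mul_one, add_zero, zero_add, pow_one, iteratedDeriv_zero] at h h2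
  have : y - x ≠ 0 := by linarith
  rw [divDiff, ← h2, h]
  field_simp

theorem stmt_5 (g : ℝ → ℝ) (u v a b : ℝ) (r s : ℕ) (hr : 1 ≤ r) (hs : 1 ≤ s)
    (huv : u < v) (hau : a < u) (hvb : v < b)
    (hg : ContDiffOn ℝ (r + s) g (Set.Ioo a b)) :
    ∫ t in u..v, iteratedDeriv (r + s - 1) g t * (t - u) ^ (s - 1) * (v - t) ^ (r - 1) =
      (v - u) ^ (r + s - 1) * mixedM g (r - 1) (s - 1) u v := by
  obtain ⟨i, rfl⟩ : ∃ i, r = i + 1 := ⟨r - 1, by omega⟩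
  obtain ⟨j, rfl⟩ : ∃ j, s = j + 1 := ⟨s - 1, by omega⟩
  have hg' : ContDiffOn ℝ ((i + j + 2 : ℕ)) g (Set.Ioo a b) := by
    convert hg using 1
    push_cast
    ring
  have e : i + 1 + (j + 1) - 1 = i + j + 1 := by omega
  simp only [e, Nat.add_sub_cancel]
  rw [auxI_subst]
  congr 1
  have key1 : ∀ x ∈ Set.Ioo a b, ∀ k ≤ j, ∀ y ∈ Set.Ioo x b,
      iteratedDeriv k (fun y => divDiff g x y) y = auxI g 0 k x y := by
    intro x hx k
    induction k with
    | zero =>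
      intro _ y hy
      rw [iteratedDeriv_zero]
      exact auxI_zero g a b _ (by omega) hg' x y hx ⟨hx.1.trans hy.1, hy.2⟩ hy.1
    | succ k ih =>
      intro hk y hy
      rw [iteratedDeriv_succ]
      have : iteratedDeriv k (fun y => divDiff g x y) =ᶠ[nhds y] fun y => auxI g 0 k x y := by
        filter_upwards [isOpen_Ioo.mem_nhds hy] with z hz using ih (by omega) z hz
      rw [this.deriv_eq]
      exact (auxI_right g a b _ 0 k (by omega) hg' x y hx ⟨hx.1.trans hy.1, hy.2⟩).deriv
  have key2 : ∀ k ≤ i, ∀ x ∈ Set.Ioo a v,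
      iteratedDeriv k (fun x => iteratedDeriv j (fun y => divDiff g x y) v) x
        = auxI g k j x v := by
    intro k
    induction k with
    | zero =>
      intro _ x hx
      rw [iteratedDeriv_zero]
      exact key1 x ⟨hx.1, hx.2.trans hvb⟩ j le_rfl v ⟨hx.2, hvb⟩
    | succ k ih =>
      intro hk x hx
      rw [iteratedDeriv_succ]
      have : iteratedDeriv k (fun x => iteratedDeriv j (fun y => divDiff g x y) v)
          =ᶠ[nhds x] fun x => auxI g k j x v := by
        filter_upwards [isOpen_Ioo.mem_nhds hx] with z hz using ih (by omega) z hz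
      rw [this.deriv_eq]
      exact (auxI_left g a b _ k j (by omega) hg' x v ⟨hx.1, hx.2.trans hvb⟩
        ⟨hau.trans huv, hvb⟩).deriv
  exact (key2 i le_rfl u ⟨hau, huv⟩).symm
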